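/- arXiv:2404.05026 — 2 statements merged into one kernel-verified Lean document; each statement's English description precedes it below -/
import Mathlib

section
/- Fix an integer k ≥ 3 and a real σ with 0 < σ < 2^{−k}. There exist c > 0 and N such that for all n ≥ N, the number of H ∈ B_n that are not σ-standard is at most |B_n| · 2^{−c·n^{k−1}}. -/
open Finset

/-- `H` is a `k`-graph on `[n]`: every edge is a `k`-element subset. -/
def IsKGraph (n k : ℕ) (H : Finset (Finset (Fin n))) : Prop :=
  ∀ e ∈ H, e.card = k

/-- `X, Y` is a bipartition of the hypergraph `H` on `[n]`. -/
def IsBipartition (n : ℕ) (H : Finset (Finset (Fin n))) (X Y : Finset (Fin n)) : Prop :=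
  Disjoint X Y ∧ X ∪ Y = Finset.univ ∧ ∀ e ∈ H, ¬ e ⊆ X ∧ ¬ e ⊆ Y

/-- `B_n`: the collection of all bipartite `k`-graphs on `[n]`. -/
def Bip (n k : ℕ) : Set (Finset (Finset (Fin n))) :=
  {H | IsKGraph n k H ∧ ∃ X Y : Finset (Fin n), IsBipartition n H X Y}

/-- `K[X,Y]`: the crossing `k`-sets, i.e. those contained neither in `X` nor in `Y`. -/
def crossing (n k : ℕ) (X Y : Finset (Fin n)) : Finset (Finset (Fin n)) :=
  (Finset.univ.powersetCard k).filter fun e => ¬ e ⊆ X ∧ ¬ e ⊆ Y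

/-- joint `H`-degree of `u` and `v`: the number of `(k-1)`-sets `J ⊆ [n] \ {u,v}`
with `{u} ∪ J ∈ H` and `{v} ∪ J ∈ H`. -/
def jointDeg (n k : ℕ) (H : Finset (Finset (Fin n))) (u v : Fin n) : ℕ :=
  (((Finset.univ \ {u, v}).powersetCard (k - 1)).filter
    fun J => insert u J ∈ H ∧ insert v J ∈ H).card

/-- `deg_H(v, U)`: the number of `(k-1)`-sets `J ⊆ U \ {v}` with `{v} ∪ J ∈ H`. -/
def degIn (n k : ℕ) (H : Finset (Finset (Fin n))) (v : Fin n) (U : Finset (Fin n)) : ℕ :=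
  (((U \ {v}).powersetCard (k - 1)).filter fun J => insert v J ∈ H).card

/-- `e_{H_J}(A, B)`: for disjoint `A`, `B`, the number of link-graph edges of `H_J`
with one endpoint in `A` and one in `B`. -/
def linkBetween (n : ℕ) (H : Finset (Finset (Fin n))) (J A B : Finset (Fin n)) : ℕ :=
  ((A ×ˢ B).filter fun p => p.1 ∉ J ∧ p.2 ∉ J ∧ insert p.1 (insert p.2 J) ∈ H).card

/-- `e_{H_J}(A)`: the number of link-graph edges of `H_J` contained in `A`. -/
def linkWithin (n : ℕ) (H : Finset (Finset (Fin n))) (J A : Finset (Fin n)) : ℕ :=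
  ((A.powersetCard 2).filter fun p => Disjoint p J ∧ p ∪ J ∈ H).card

/-- The bipartition `X, Y` is `σ`-standard w.r.t. `H`. -/
def SigmaStandardWrt (n k : ℕ) (σ : ℝ) (H : Finset (Finset (Fin n)))
    (X Y : Finset (Fin n)) : Prop :=
  ∀ u v : Fin n, u ≠ v →
    (((u ∈ X ∧ v ∈ X) ∨ (u ∈ Y ∧ v ∈ Y)) →
      |(jointDeg n k H u v : ℝ) -
          (1 / 4 : ℝ) * (n.choose (k - 1) : ℝ) * (1 - (2 : ℝ) ^ (1 - (k : ℤ)))|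
        ≤ σ * ((1 / 4 : ℝ) * (n.choose (k - 1) : ℝ))) ∧
    (¬ ((u ∈ X ∧ v ∈ X) ∨ (u ∈ Y ∧ v ∈ Y)) →
      |(jointDeg n k H u v : ℝ) -
          (1 / 4 : ℝ) * (n.choose (k - 1) : ℝ) * (1 - (2 : ℝ) ^ (2 - (k : ℤ)))|
        ≤ σ * ((1 / 4 : ℝ) * (n.choose (k - 1) : ℝ)))

/-- `H` is `σ`-standard: every bipartition of `H` is `σ`-standard w.r.t. `H`. -/
def SigmaStandard (n k : ℕ) (σ : ℝ) (H : Finset (Finset (Fin n))) : Prop :=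
  ∀ X Y : Finset (Fin n), IsBipartition n H X Y → SigmaStandardWrt n k σ H X Y

/-- Generating function of the number of pairs `a i, b i` both lying in a uniformly chosen subset
of `E`, when these pairs are pairwise disjoint. -/
lemma sum_powerset_pow_card_pairs {α ι : Type*} [DecidableEq α] [DecidableEq ι]
    (a b : ι → α) (x : ℝ) (S : Finset ι) (E : Finset α)
    (hE : ∀ i ∈ S, a i ∈ E ∧ b i ∈ E) (hab : ∀ i ∈ S, ∀ j ∈ S, a i ≠ b j)
    (ha : Set.InjOn a S) (hb : Set.InjOn b S) :
    ∑ H ∈ E.powerset, x ^ #{i ∈ S | a i ∈ H ∧ b i ∈ H} = 2 ^ #E * ((3 + x) / 4) ^ #S := by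
  induction S using Finset.induction_on generalizing E with
  | empty => simp
  | insert i S hi ih =>
    obtain ⟨haE, hbE⟩ := hE i (mem_insert_self _ _)
    have hne : a i ≠ b i := hab i (mem_insert_self _ _) i (mem_insert_self _ _)
    have ha' : ∀ j ∈ S, a j ≠ a i := fun j hj h =>
      hi (ha (by simp [hj]) (by simp) h ▸ hj)
    have hb' : ∀ j ∈ S, b j ≠ b i := fun j hj h =>
      hi (hb (by simp [hj]) (by simp) h ▸ hj)
    have hab1 : ∀ j ∈ S, a j ≠ b i := fun j hj => hab j (by simp [hj]) i (by simp)
    have hab2 : ∀ j ∈ S, b j ≠ a i := fun j hj => (hab i (by simp) j (by simp [hj])).symm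
    obtain ⟨F, hF⟩ : ∃ F, F = (E.erase (a i)).erase (b i) := ⟨_, rfl⟩
    have hbF : b i ∉ F := by simp [hF]
    have haF : a i ∉ F := by simp [hF]
    have haF' : a i ∉ insert (b i) F := by simp [hne, haF]
    have hEF : E = insert (a i) (insert (b i) F) := by
      rw [hF, insert_erase (by simp [hne.symm, hbE]), insert_erase haE]
    have key := ih F
      (fun j hj => by
        have := hE j (by simp [hj])
        simp [hF, this, ha' j hj, hb' j hj, hab1 j hj, hab2 j hj])
      (fun j hj l hl => hab j (by simp [hj]) l (by simp [hl]))
      (ha.mono (by simp)) (hb.mono (by simp))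
    have hS : ∀ H : Finset α, ∀ A : Finset α,
        (∀ j ∈ S, (a j ∈ A ↔ a j ∈ H) ∧ (b j ∈ A ↔ b j ∈ H)) →
        #{j ∈ insert i S | a j ∈ A ∧ b j ∈ A} =
          #{j ∈ S | a j ∈ H ∧ b j ∈ H} + if a i ∈ A ∧ b i ∈ A then 1 else 0 := by
      intro H A h
      have : #{j ∈ S | a j ∈ A ∧ b j ∈ A} = #{j ∈ S | a j ∈ H ∧ b j ∈ H} := by
        congr 1
        exact filter_congr fun j hj => by rw [(h j hj).1, (h j hj).2]
      rw [filter_insert]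
      split_ifs
      · rw [card_insert_of_notMem (by simp [hi]), this]
      · simpa using this
    rw [hEF, sum_powerset_insert haF', sum_powerset_insert hbF, sum_powerset_insert hbF,
      card_insert_of_notMem haF', card_insert_of_notMem hbF, card_insert_of_notMem hi]
    have e1 : ∀ H ∈ F.powerset, x ^ #{j ∈ insert i S | a j ∈ H ∧ b j ∈ H} =
        x ^ #{j ∈ S | a j ∈ H ∧ b j ∈ H} := fun H hH => by
      rw [hS H H (by simp),
        if_neg (fun h => haF (mem_powerset.1 hH h.1)), add_zero]
    have e2 : ∀ H ∈ F.powerset, x ^ #{j ∈ insert i S | a j ∈ insert (b i) H ∧ b j ∈ insert (b i) H} =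
        x ^ #{j ∈ S | a j ∈ H ∧ b j ∈ H} := fun H hH => by
      rw [hS H _ (fun j hj => by simp [hb' j hj, hab1 j hj]),
        if_neg (fun h => haF' (insert_subset_insert _ (mem_powerset.1 hH) h.1)), add_zero]
    have e3 : ∀ H ∈ F.powerset, x ^ #{j ∈ insert i S | a j ∈ insert (a i) H ∧ b j ∈ insert (a i) H} =
        x ^ #{j ∈ S | a j ∈ H ∧ b j ∈ H} := fun H hH => by
      rw [hS H _ (fun j hj => by simp [ha' j hj, hab2 j hj]),
        if_neg (fun h => hbF (mem_powerset.1 hH (by simpa [hne.symm] using h.2))), add_zero]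
    have e4 : ∀ H ∈ F.powerset, x ^ #{j ∈ insert i S | a j ∈ insert (a i) (insert (b i) H) ∧
          b j ∈ insert (a i) (insert (b i) H)} =
        x ^ #{j ∈ S | a j ∈ H ∧ b j ∈ H} * x := fun H hH => by
      rw [hS H _
        (fun j hj => by simp [ha' j hj, hab2 j hj, hb' j hj, hab1 j hj]),
        if_pos (by simp), pow_succ]
    rw [sum_congr rfl e1, sum_congr rfl e2, sum_congr rfl e3, sum_congr rfl e4, ← sum_mul, key]
    ring

lemma card_exp_moment_le {α ι : Type*} [DecidableEq α] [DecidableEq ι]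
    (a b : ι → α) (S : Finset ι) (E : Finset α)
    (hE : ∀ i ∈ S, a i ∈ E ∧ b i ∈ E) (hab : ∀ i ∈ S, ∀ j ∈ S, a i ≠ b j)
    (ha : Set.InjOn a S) (hb : Set.InjOn b S) (l s : ℝ) (hl : |l| ≤ 1) :
    (#{H ∈ E.powerset | s < l * ((#{i ∈ S | a i ∈ H ∧ b i ∈ H} : ℝ) - #S / 4)} : ℝ) ≤
      2 ^ #E * Real.exp (#S * l ^ 2 / 4 - s) := by
  have h1 : (#{H ∈ E.powerset | s < l * ((#{i ∈ S | a i ∈ H ∧ b i ∈ H} : ℝ) - #S / 4)} : ℝ) ≤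
      ∑ H ∈ E.powerset, Real.exp (-(l * #S / 4) - s) *
        Real.exp l ^ #{i ∈ S | a i ∈ H ∧ b i ∈ H} := by
    rw [card_filter, Nat.cast_sum]
    refine sum_le_sum fun H _ => ?_
    rw [← Real.exp_nat_mul, ← Real.exp_add]
    split_ifs with h
    · rw [Nat.cast_one]
      exact Real.one_le_exp (by linarith)
    · simpa using (Real.exp_pos _).le
  rw [← mul_sum, sum_powerset_pow_card_pairs a b _ S E hE hab ha hb] at h1
  refine h1.trans ?_
  have h2 : (3 + Real.exp l) / 4 ≤ Real.exp (l / 4 + l ^ 2 / 4) := by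
    have := (abs_le.1 (Real.abs_exp_sub_one_sub_id_le hl)).2
    have := Real.add_one_le_exp (l / 4 + l ^ 2 / 4)
    linarith
  have h3 : ((3 + Real.exp l) / 4) ^ #S ≤ Real.exp (#S * (l / 4 + l ^ 2 / 4)) := by
    rw [Real.exp_nat_mul]
    exact pow_le_pow_left₀ (by positivity) h2 _
  calc Real.exp (-(l * #S / 4) - s) * (2 ^ #E * ((3 + Real.exp l) / 4) ^ #S)
      ≤ Real.exp (-(l * #S / 4) - s) * (2 ^ #E * Real.exp (#S * (l / 4 + l ^ 2 / 4))) := by gcongr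
    _ = 2 ^ #E * (Real.exp (-(l * #S / 4) - s) * Real.exp (#S * (l / 4 + l ^ 2 / 4))) := by ring
    _ = _ := by
      rw [← Real.exp_add]
      congr 2
      ring

/-- Concentration of the number of pairs `a i, b i` contained in a random subset of `E`. -/
lemma card_pairs_deviation_le {α ι : Type*} [DecidableEq α] [DecidableEq ι]
    (a b : ι → α) (S : Finset ι) (E : Finset α)
    (hE : ∀ i ∈ S, a i ∈ E ∧ b i ∈ E) (hab : ∀ i ∈ S, ∀ j ∈ S, a i ≠ b j)
    (ha : Set.InjOn a S) (hb : Set.InjOn b S) (ε M : ℝ) (hε0 : 0 ≤ ε) (hε : ε ≤ 1 / 2)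
    (hM : (#S : ℝ) ≤ M) :
    (#{H ∈ E.powerset | ε * M < |(#{i ∈ S | a i ∈ H ∧ b i ∈ H} : ℝ) - #S / 4|} : ℝ) ≤
      2 * 2 ^ #E * Real.exp (-(ε ^ 2 * M)) := by
  rcases hε0.eq_or_lt with rfl | hpos
  · have : (#{H ∈ E.powerset | 0 * M < |(#{i ∈ S | a i ∈ H ∧ b i ∈ H} : ℝ) - #S / 4|} : ℝ) ≤
        2 ^ #E := by
      exact_mod_cast (card_filter_le _ _).trans (card_powerset E).le
    have h0 : (0 : ℝ) < 2 ^ #E := by positivity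
    simp only [ne_eq, OfNat.ofNat_ne_zero, not_false_eq_true, zero_pow, zero_mul, neg_zero,
      Real.exp_zero, mul_one] at this ⊢
    linarith
  have hp := card_exp_moment_le a b S E hE hab ha hb (2 * ε) (2 * ε * (ε * M))
    (by rw [abs_of_nonneg] <;> linarith)
  have hn := card_exp_moment_le a b S E hE hab ha hb (-(2 * ε)) (2 * ε * (ε * M))
    (by rw [abs_neg, abs_of_nonneg] <;> linarith)
  have hexp : ∀ l : ℝ, l ^ 2 = (2 * ε) ^ 2 →
      Real.exp (#S * l ^ 2 / 4 - 2 * ε * (ε * M)) ≤ Real.exp (-(ε ^ 2 * M)) := by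
    intro l hl
    rw [Real.exp_le_exp, hl]
    nlinarith [mul_le_mul_of_nonneg_left hM (sq_nonneg ε)]
  have hsub : {H ∈ E.powerset | ε * M < |(#{i ∈ S | a i ∈ H ∧ b i ∈ H} : ℝ) - #S / 4|} ⊆
      {H ∈ E.powerset | 2 * ε * (ε * M) <
        2 * ε * ((#{i ∈ S | a i ∈ H ∧ b i ∈ H} : ℝ) - #S / 4)} ∪
      {H ∈ E.powerset | 2 * ε * (ε * M) <
        -(2 * ε) * ((#{i ∈ S | a i ∈ H ∧ b i ∈ H} : ℝ) - #S / 4)} := by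
    intro H hH
    simp only [mem_union, mem_filter] at hH ⊢
    rcases lt_abs.1 hH.2 with h | h
    · exact Or.inl ⟨hH.1, mul_lt_mul_of_pos_left h (by linarith)⟩
    · refine Or.inr ⟨hH.1, ?_⟩
      rw [neg_mul, ← mul_neg]
      exact mul_lt_mul_of_pos_left h (by linarith)
  have hcard := (card_le_card hsub).trans (card_union_le _ _)
  have hcard' : (#{H ∈ E.powerset | ε * M < |(#{i ∈ S | a i ∈ H ∧ b i ∈ H} : ℝ) - #S / 4|} : ℝ) ≤
      #{H ∈ E.powerset | 2 * ε * (ε * M) <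
        2 * ε * ((#{i ∈ S | a i ∈ H ∧ b i ∈ H} : ℝ) - #S / 4)} +
      #{H ∈ E.powerset | 2 * ε * (ε * M) <
        -(2 * ε) * ((#{i ∈ S | a i ∈ H ∧ b i ∈ H} : ℝ) - #S / 4)} := by
    exact_mod_cast hcard
  have := mul_le_mul_of_nonneg_left (hexp (2 * ε) rfl) (show (0 : ℝ) ≤ 2 ^ #E by positivity)
  have := mul_le_mul_of_nonneg_left (hexp (-(2 * ε)) (by ring))
    (show (0 : ℝ) ≤ 2 ^ #E by positivity)
  linarith

lemma abs_descFactorial_sub_pow_le (j n x : ℕ) (hx : x ≤ n) :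
    |(x.descFactorial j : ℝ) - (x : ℝ) ^ j| ≤ (j : ℝ) ^ 2 * (n : ℝ) ^ (j - 1) := by
  have hup : (x.descFactorial j : ℝ) ≤ (x : ℝ) ^ j := by
    exact_mod_cast Nat.descFactorial_le_pow x j
  have hlow : ((x + 1 - j : ℕ) : ℝ) ^ j ≤ (x.descFactorial j : ℝ) := by
    exact_mod_cast Nat.pow_sub_le_descFactorial x j
  rcases Nat.eq_zero_or_pos j with rfl | hj
  · simp
  have hdiff : |(x : ℝ) ^ j - ((x + 1 - j : ℕ) : ℝ) ^ j| ≤ j * j * (n : ℝ) ^ (j - 1) := by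
    refine (abs_pow_sub_pow_le _ _ _).trans ?_
    have h1 : |(x : ℝ) - ((x + 1 - j : ℕ) : ℝ)| ≤ j := by
      have h2 : x ≤ (x + 1 - j) + j := by omega
      have h3 : x + 1 - j ≤ x := by omega
      have h2' : (x : ℝ) ≤ ((x + 1 - j : ℕ) : ℝ) + j := by exact_mod_cast h2
      have h3' : ((x + 1 - j : ℕ) : ℝ) ≤ x := by exact_mod_cast h3
      rw [abs_of_nonneg] <;> linarith
    have h4 : max |(x : ℝ)| |((x + 1 - j : ℕ) : ℝ)| ≤ n := by
      rw [Nat.abs_cast, Nat.abs_cast]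
      refine max_le (by exact_mod_cast hx) ?_
      exact_mod_cast (show x + 1 - j ≤ n by omega)
    gcongr
  have := (abs_le.1 hdiff).2
  rw [abs_sub_comm, abs_of_nonneg (by linarith)]
  nlinarith

lemma pow_div_le_choose (j n : ℕ) (hn : 2 * j ^ 2 ≤ n) :
    (n : ℝ) ^ j / (2 * j.factorial) ≤ n.choose j := by
  have hf : (0 : ℝ) < j.factorial := by exact_mod_cast j.factorial_pos
  have h := (abs_le.1 (abs_descFactorial_sub_pow_le j n n le_rfl)).1
  rw [Nat.descFactorial_eq_factorial_mul_choose] at h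
  push_cast at h
  have hn' : 2 * (j : ℝ) ^ 2 ≤ n := by exact_mod_cast hn
  have h2 : 2 * ((j : ℝ) ^ 2 * (n : ℝ) ^ (j - 1)) ≤ (n : ℝ) ^ j := by
    rcases Nat.eq_zero_or_pos j with rfl | hj
    · simp
    calc 2 * ((j : ℝ) ^ 2 * (n : ℝ) ^ (j - 1)) = 2 * (j : ℝ) ^ 2 * (n : ℝ) ^ (j - 1) := by ring
      _ ≤ n * (n : ℝ) ^ (j - 1) := by gcongr
      _ = (n : ℝ) ^ j := by rw [← pow_succ', Nat.sub_add_cancel hj]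
  rw [div_le_iff₀ (by positivity)]
  linarith

/-- If `x / n` is close to `w`, then `x.choose j` is close to `w ^ j * n.choose j`. -/
lemma exists_abs_choose_sub_le (j : ℕ) (η : ℝ) (hη : 0 < η) :
    ∃ δ : ℝ, 0 < δ ∧ ∃ N : ℕ, ∀ n : ℕ, N ≤ n → ∀ x : ℕ, x ≤ n → ∀ w : ℝ, 0 ≤ w → w ≤ 1 →
      |(x : ℝ) - w * n| ≤ δ * n →
        |(x.choose j : ℝ) - w ^ j * n.choose j| ≤ η * n.choose j := by
  rcases Nat.eq_zero_or_pos j with rfl | hj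
  · exact ⟨1, one_pos, 0, fun n _ x _ w _ _ _ => by simpa using hη.le⟩
  have hjR : (0 : ℝ) < j := by exact_mod_cast hj
  obtain ⟨N, hN⟩ := exists_nat_ge (8 * (j : ℝ) ^ 2 / η)
  refine ⟨η / (4 * j), by positivity, max N (2 * j ^ 2), fun n hn x hx w hw0 hw1 hxw => ?_⟩
  have hf : (0 : ℝ) < j.factorial := by exact_mod_cast j.factorial_pos
  have hNn : (N : ℝ) ≤ n := by exact_mod_cast (le_max_left _ _).trans hn
  have hlow := pow_div_le_choose j n ((le_max_right _ _).trans hn)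
  rw [div_le_iff₀ (by positivity)] at hlow
  rw [div_le_iff₀ hη] at hN
  have hpow : (n : ℝ) ^ j = n * (n : ℝ) ^ (j - 1) := by rw [← pow_succ', Nat.sub_add_cancel hj]
  have hP : (0 : ℝ) ≤ (n : ℝ) ^ (j - 1) := by positivity
  have h1 := abs_descFactorial_sub_pow_le j n x hx
  have h2 := abs_descFactorial_sub_pow_le j n n le_rfl
  rw [Nat.descFactorial_eq_factorial_mul_choose, Nat.cast_mul] at h1 h2
  have h3 : |(x : ℝ) ^ j - (w * n) ^ j| ≤ η / 4 * (n : ℝ) ^ j := by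
    refine (abs_pow_sub_pow_le _ _ _).trans ?_
    have h4 : max |(x : ℝ)| |w * n| ≤ n := by
      rw [Nat.abs_cast, abs_of_nonneg (by positivity)]
      refine max_le (by exact_mod_cast hx) ?_
      exact mul_le_of_le_one_left (by positivity) hw1
    calc |(x : ℝ) - w * n| * j * max |(x : ℝ)| |w * n| ^ (j - 1)
        ≤ η / (4 * j) * n * j * (n : ℝ) ^ (j - 1) := by gcongr
      _ = η / 4 * (n : ℝ) ^ j := by
        rw [hpow]
        field_simp
  have hsmall : 2 * ((j : ℝ) ^ 2 * (n : ℝ) ^ (j - 1)) ≤ η / 4 * (n : ℝ) ^ j := by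
    rw [hpow]
    have : 8 * (j : ℝ) ^ 2 ≤ n * η := hN.trans (by gcongr)
    nlinarith
  have h5 : |w ^ j * (n : ℝ) ^ j - w ^ j * (j.factorial * n.choose j)| ≤
      (j : ℝ) ^ 2 * (n : ℝ) ^ (j - 1) := by
    rw [← mul_sub, abs_mul, abs_of_nonneg (by positivity), abs_sub_comm]
    exact (mul_le_of_le_one_left (abs_nonneg _) (pow_le_one₀ hw0 hw1)).trans h2
  rw [mul_pow] at h3
  have h6 : |(j.factorial : ℝ) * ((x.choose j : ℝ) - w ^ j * n.choose j)| ≤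
      j.factorial * (η * n.choose j) := by
    rw [abs_le] at h1 h3 h5 ⊢
    have := mul_le_mul_of_nonneg_left hlow hη.le
    constructor <;> nlinarith
  rw [abs_mul, abs_of_pos hf] at h6
  exact le_of_mul_le_mul_left h6 hf

lemma pow_add_pow_ge (a b : ℝ) (ha : 0 ≤ a) (hb : 0 ≤ b) (m : ℕ) :
    ((a + b) / 2) ^ m * (a ^ 2 + b ^ 2) ≤ a ^ (m + 2) + b ^ (m + 2) := by
  induction m with
  | zero => simp
  | succ m ih =>
    have h : 0 ≤ (a ^ (m + 2) - b ^ (m + 2)) * (a - b) := by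
      rcases le_total a b with hab | hab
      · exact mul_nonneg_of_nonpos_of_nonpos
          (sub_nonpos.2 (pow_le_pow_left₀ ha hab _)) (sub_nonpos.2 hab)
      · exact mul_nonneg (sub_nonneg.2 (pow_le_pow_left₀ hb hab _)) (sub_nonneg.2 hab)
    calc ((a + b) / 2) ^ (m + 1) * (a ^ 2 + b ^ 2)
        = (a + b) / 2 * (((a + b) / 2) ^ m * (a ^ 2 + b ^ 2)) := by ring
      _ ≤ (a + b) / 2 * (a ^ (m + 2) + b ^ (m + 2)) := by gcongr
      _ ≤ a ^ (m + 1 + 2) + b ^ (m + 1 + 2) := by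
        have e1 : a ^ (m + 1 + 2) = a ^ (m + 2) * a := by ring
        have e2 : b ^ (m + 1 + 2) = b ^ (m + 2) * b := by ring
        rw [e1, e2]
        nlinarith

lemma card_filter_not_subset {α : Type*} [DecidableEq α] (A X : Finset α) (j : ℕ) :
    #{e ∈ A.powersetCard j | ¬ e ⊆ X} + (#(A ∩ X)).choose j = (#A).choose j := by
  have h : {e ∈ A.powersetCard j | e ⊆ X} = (A ∩ X).powersetCard j := by
    ext e
    simp only [mem_filter, mem_powersetCard, subset_inter_iff]
    tauto
  rw [← card_powersetCard j (A ∩ X), ← h, ← card_powersetCard j A, add_comm]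
  exact card_filter_add_card_filter_not _

lemma card_filter_not_subset_and {α : Type*} [DecidableEq α] (A X Y : Finset α) (j : ℕ)
    (hj : 1 ≤ j) (hXY : Disjoint X Y) :
    #{e ∈ A.powersetCard j | ¬ e ⊆ X ∧ ¬ e ⊆ Y} + (#(A ∩ X)).choose j + (#(A ∩ Y)).choose j =
      (#A).choose j := by
  have h : {e ∈ {e ∈ A.powersetCard j | ¬ e ⊆ X} | e ⊆ Y} = (A ∩ Y).powersetCard j := by
    ext e
    simp only [mem_filter, mem_powersetCard, subset_inter_iff]
    constructor
    · tauto
    · rintro ⟨⟨h1, h2⟩, h3⟩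
      refine ⟨⟨⟨h1, h3⟩, fun h4 => ?_⟩, h2⟩
      obtain ⟨x, hx⟩ := card_pos.1 (show 0 < #e by omega)
      exact disjoint_left.1 hXY (h4 hx) (h2 hx)
  have h1 := card_filter_not_subset A X j
  have h2 := card_filter_add_card_filter_not (s := {e ∈ A.powersetCard j | ¬ e ⊆ X}) (· ⊆ Y)
  rw [h, card_powersetCard, filter_filter] at h2
  omega

lemma card_crossing (n k : ℕ) (hk : 1 ≤ k) (X : Finset (Fin n)) :
    #(crossing n k X Xᶜ) + (#X).choose k + (n - #X).choose k = n.choose k := by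
  have h := card_filter_not_subset_and univ X Xᶜ k hk disjoint_compl_right
  rw [univ_inter, univ_inter, card_compl, card_univ, Fintype.card_fin] at h
  exact h

/-- The `(k-1)`-sets avoiding `u` and `v` that form a crossing `k`-set with each of them. -/
def crossingPairs (n k : ℕ) (X : Finset (Fin n)) (u v : Fin n) : Finset (Finset (Fin n)) :=
  ((univ \ {u, v}).powersetCard (k - 1)).filter
    fun J => insert u J ∈ crossing n k X Xᶜ ∧ insert v J ∈ crossing n k X Xᶜ

lemma insert_mem_crossing (n k : ℕ) (hk : 1 ≤ k) (X J : Finset (Fin n)) (u : Fin n)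
    (hJ : #J = k - 1) (hu : u ∉ J) :
    insert u J ∈ crossing n k X Xᶜ ↔ (u ∈ X → ¬ J ⊆ X) ∧ (u ∉ X → ¬ J ⊆ Xᶜ) := by
  have hc : #(insert u J) = k := by rw [card_insert_of_notMem hu, hJ]; omega
  simp only [crossing, mem_filter, mem_powersetCard, subset_univ, true_and, hc, insert_subset_iff,
    mem_compl]
  tauto

lemma crossing_compl (n k : ℕ) (X : Finset (Fin n)) :
    crossing n k Xᶜ Xᶜᶜ = crossing n k X Xᶜ := by
  rw [compl_compl]
  unfold crossing
  exact filter_congr fun _ _ => and_comm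

lemma crossingPairs_compl (n k : ℕ) (X : Finset (Fin n)) (u v : Fin n) :
    crossingPairs n k Xᶜ u v = crossingPairs n k X u v := by
  unfold crossingPairs
  rw [crossing_compl]

lemma card_sdiff_pair {n : ℕ} {u v : Fin n} (huv : u ≠ v) : #(univ \ {u, v}) = n - 2 := by
  rw [card_sdiff_of_subset (subset_univ _), card_univ, Fintype.card_fin, card_pair huv]

lemma card_crossingPairs_same (n k : ℕ) (hk : 2 ≤ k) (X : Finset (Fin n)) {u v : Fin n}
    (huv : u ≠ v) (hu : u ∈ X) (hv : v ∈ X) :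
    #(crossingPairs n k X u v) + (#X - 2).choose (k - 1) = (n - 2).choose (k - 1) := by
  have h := card_filter_not_subset (univ \ {u, v}) X (k - 1)
  rw [card_sdiff_pair huv] at h
  have h1 : #((univ \ {u, v}) ∩ X) = #X - 2 := by
    rw [show (univ \ {u, v}) ∩ X = X \ {u, v} by ext; simp [and_comm],
      card_sdiff_of_subset (by simp [insert_subset_iff, hu, hv]), card_pair huv]
  rw [h1] at h
  rw [← h]
  congr 2
  refine filter_congr fun J hJ => ?_
  rw [mem_powersetCard] at hJ
  have hJu : u ∉ J := fun h => by simpa using hJ.1 h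
  have hJv : v ∉ J := fun h => by simpa using hJ.1 h
  rw [insert_mem_crossing n k (by omega) X J u hJ.2 hJu,
    insert_mem_crossing n k (by omega) X J v hJ.2 hJv]
  tauto

lemma card_crossingPairs_diff (n k : ℕ) (hk : 2 ≤ k) (X : Finset (Fin n)) {u v : Fin n}
    (hu : u ∈ X) (hv : v ∉ X) :
    #(crossingPairs n k X u v) + (#X - 1).choose (k - 1) + (n - #X - 1).choose (k - 1) =
      (n - 2).choose (k - 1) := by
  have huv : u ≠ v := fun h => hv (h ▸ hu)
  have h := card_filter_not_subset_and (univ \ {u, v}) X Xᶜ (k - 1) (by omega)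
    disjoint_compl_right
  rw [card_sdiff_pair huv] at h
  have h1 : #((univ \ {u, v}) ∩ X) = #X - 1 := by
    rw [show (univ \ {u, v}) ∩ X = X.erase u by ext; simp; grind, card_erase_of_mem hu]
  have h2 : #((univ \ {u, v}) ∩ Xᶜ) = n - #X - 1 := by
    rw [show (univ \ {u, v}) ∩ Xᶜ = Xᶜ.erase v by ext; simp; grind,
      card_erase_of_mem (by simpa using hv), card_compl, Fintype.card_fin]
  rw [h1, h2] at h
  rw [← h]
  congr 3
  refine filter_congr fun J hJ => ?_
  rw [mem_powersetCard] at hJ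
  have hJu : u ∉ J := fun h => by simpa using hJ.1 h
  have hJv : v ∉ J := fun h => by simpa using hJ.1 h
  rw [insert_mem_crossing n k (by omega) X J u hJ.2 hJu,
    insert_mem_crossing n k (by omega) X J v hJ.2 hJv]
  tauto

lemma card_crossingPairs_le (n k : ℕ) (X : Finset (Fin n)) (u v : Fin n) :
    #(crossingPairs n k X u v) ≤ n.choose (k - 1) := by
  refine (card_filter_le _ _).trans ?_
  rw [card_powersetCard]
  exact Nat.choose_le_choose _ ((card_le_univ _).trans (Fintype.card_fin n).le)

lemma jointDeg_eq (n k : ℕ) (X : Finset (Fin n)) (H : Finset (Finset (Fin n)))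
    (hH : H ⊆ crossing n k X Xᶜ) (u v : Fin n) :
    jointDeg n k H u v = #{J ∈ crossingPairs n k X u v | insert u J ∈ H ∧ insert v J ∈ H} := by
  unfold jointDeg crossingPairs
  rw [filter_filter]
  congr 1
  exact filter_congr fun J _ => ⟨fun h => ⟨⟨hH h.1, hH h.2⟩, h⟩, fun h => h.2⟩

lemma card_jointDeg_deviation_le (n k : ℕ) (X : Finset (Fin n)) {u v : Fin n} (huv : u ≠ v)
    (ε : ℝ) (hε0 : 0 ≤ ε) (hε : ε ≤ 1 / 2) :
    (#{H ∈ (crossing n k X Xᶜ).powerset | ε * n.choose (k - 1) <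
        |(jointDeg n k H u v : ℝ) - #(crossingPairs n k X u v) / 4|} : ℝ) ≤
      2 * 2 ^ #(crossing n k X Xᶜ) * Real.exp (-(ε ^ 2 * n.choose (k - 1))) := by
  have hmem : ∀ J ∈ crossingPairs n k X u v, u ∉ J ∧ v ∉ J := by
    intro J hJ
    have := (mem_powersetCard.1 (mem_filter.1 hJ).1).1
    exact ⟨fun h => by simpa using this h, fun h => by simpa using this h⟩
  have h := card_pairs_deviation_le (fun J => insert u J) (fun J => insert v J)
    (crossingPairs n k X u v) (crossing n k X Xᶜ) (fun J hJ => (mem_filter.1 hJ).2)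
    (fun I hI J hJ h => by
      have : u ∈ insert v J := h ▸ mem_insert_self u I
      rcases mem_insert.1 this with h' | h'
      · exact huv h'
      · exact (hmem J hJ).1 h')
    (fun I hI J hJ h => by
      rw [← erase_insert (hmem I hI).1, ← erase_insert (hmem J hJ).1]
      exact congrArg (fun s => s.erase u) h)
    (fun I hI J hJ h => by
      rw [← erase_insert (hmem I hI).2, ← erase_insert (hmem J hJ).2]
      exact congrArg (fun s => s.erase v) h)
    ε (n.choose (k - 1)) hε0 hε (by exact_mod_cast card_crossingPairs_le n k X u v)
  refine le_trans (le_of_eq ?_) h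
  congr 2
  exact filter_congr fun H hH => by rw [jointDeg_eq n k X H (mem_powerset.1 hH)]

/-- The expected joint degrees are close to their asymptotic values in a balanced bipartition. -/
lemma exists_crossingPairs_close (k : ℕ) (hk : 2 ≤ k) (η : ℝ) (hη : 0 < η) :
    ∃ δ : ℝ, 0 < δ ∧ ∃ N : ℕ, ∀ n : ℕ, N ≤ n → ∀ X : Finset (Fin n),
      |(#X : ℝ) - 1 / 2 * n| ≤ δ * n → ∀ u v : Fin n, u ≠ v →
        (((u ∈ X ∧ v ∈ X) ∨ (u ∈ Xᶜ ∧ v ∈ Xᶜ)) →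
          |(#(crossingPairs n k X u v) : ℝ) -
            n.choose (k - 1) * (1 - (2 : ℝ) ^ (1 - (k : ℤ)))| ≤ η * n.choose (k - 1)) ∧
        (¬ ((u ∈ X ∧ v ∈ X) ∨ (u ∈ Xᶜ ∧ v ∈ Xᶜ)) →
          |(#(crossingPairs n k X u v) : ℝ) -
            n.choose (k - 1) * (1 - (2 : ℝ) ^ (2 - (k : ℤ)))| ≤ η * n.choose (k - 1)) := by
  obtain ⟨δ, hδ, N, hN⟩ := exists_abs_choose_sub_le (k - 1) (η / 3) (by positivity)
  obtain ⟨N', hN'⟩ := exists_nat_ge (4 / δ)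
  refine ⟨δ / 2, by positivity, max N N', fun n hn X hX u v huv => ?_⟩
  have hNn : N ≤ n := (le_max_left _ _).trans hn
  have hn4 : 2 ≤ δ / 2 * n := by
    have : (N' : ℝ) ≤ n := by exact_mod_cast (le_max_right _ _).trans hn
    rw [div_le_iff₀ hδ] at hN'
    nlinarith
  have hz1 : (2 : ℝ) ^ (1 - (k : ℤ)) = (1 / 2) ^ (k - 1) := by
    rw [show (1 - (k : ℤ)) = -((k - 1 : ℕ) : ℤ) by push_cast [show 1 ≤ k by omega]; ring,
      zpow_neg, zpow_natCast, one_div, inv_pow]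
  have hz2 : (2 : ℝ) ^ (2 - (k : ℤ)) = 2 * (1 / 2) ^ (k - 1) := by
    rw [show (2 - (k : ℤ)) = 1 + (1 - (k : ℤ)) by ring, zpow_add₀ two_ne_zero, hz1, zpow_one]
  have hn2 : 2 ≤ n := by
    have := Fintype.one_lt_card_iff.2 ⟨u, v, huv⟩
    rwa [Fintype.card_fin] at this
  have hT : |((n - 2 : ℕ).choose (k - 1) : ℝ) - n.choose (k - 1)| ≤
      η / 3 * n.choose (k - 1) := by
    have := hN n hNn (n - 2) (Nat.sub_le _ _) 1 zero_le_one le_rfl (by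
      push_cast [hn2]
      rw [abs_le]
      constructor <;> linarith)
    simpa using this
  have hhalf : ∀ x d : ℕ, d ≤ 2 → x ≤ n → |(x : ℝ) - 1 / 2 * n| ≤ δ / 2 * n →
      |((x - d : ℕ).choose (k - 1) : ℝ) - (1 / 2) ^ (k - 1) * n.choose (k - 1)| ≤
        η / 3 * n.choose (k - 1) := by
    intro x d hd hxn hx
    refine hN n hNn (x - d) ((Nat.sub_le _ _).trans hxn) (1 / 2) (by norm_num) (by norm_num) ?_
    have h1 : ((x - d : ℕ) : ℝ) ≤ x := by exact_mod_cast Nat.sub_le _ _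
    have h2 : (x : ℝ) ≤ ((x - d : ℕ) : ℝ) + 2 := by
      exact_mod_cast (show x ≤ x - d + 2 by omega)
    rw [abs_le] at hx ⊢
    constructor <;> linarith
  have hM : (0 : ℝ) ≤ η / 3 * n.choose (k - 1) := by positivity
  have hle : ∀ Z : Finset (Fin n), #Z ≤ n := fun Z =>
    (card_le_univ _).trans (Fintype.card_fin n).le
  have hcompl : ∀ Z : Finset (Fin n), |(#Z : ℝ) - 1 / 2 * n| ≤ δ / 2 * n →
      |(#Zᶜ : ℝ) - 1 / 2 * n| ≤ δ / 2 * n := by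
    intro Z hZ
    rw [card_compl, Fintype.card_fin, Nat.cast_sub (hle Z)]
    rw [abs_le] at hZ ⊢
    constructor <;> linarith
  have same : ∀ Z : Finset (Fin n), |(#Z : ℝ) - 1 / 2 * n| ≤ δ / 2 * n → u ∈ Z → v ∈ Z →
      |(#(crossingPairs n k Z u v) : ℝ) - n.choose (k - 1) * (1 - (1 / 2) ^ (k - 1))| ≤
        η * n.choose (k - 1) := by
    intro Z hZ hu hv
    have h1 : (#(crossingPairs n k Z u v) : ℝ) + (#Z - 2 : ℕ).choose (k - 1) =
        (n - 2 : ℕ).choose (k - 1) := by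
      exact_mod_cast card_crossingPairs_same n k hk Z huv hu hv
    have h2 := hhalf #Z 2 le_rfl (hle Z) hZ
    rw [abs_le] at h2 hT ⊢
    constructor <;> linarith
  have diff : ∀ Z : Finset (Fin n), |(#Z : ℝ) - 1 / 2 * n| ≤ δ / 2 * n → u ∈ Z → v ∉ Z →
      |(#(crossingPairs n k Z u v) : ℝ) - n.choose (k - 1) * (1 - 2 * (1 / 2) ^ (k - 1))| ≤
        η * n.choose (k - 1) := by
    intro Z hZ hu hv
    have h1 : (#(crossingPairs n k Z u v) : ℝ) + (#Z - 1 : ℕ).choose (k - 1) +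
        (n - #Z - 1 : ℕ).choose (k - 1) = (n - 2 : ℕ).choose (k - 1) := by
      exact_mod_cast card_crossingPairs_diff n k hk Z hu hv
    have h2 := hhalf #Z 1 one_le_two (hle Z) hZ
    have h3 := hhalf #Zᶜ 1 one_le_two (hle _) (hcompl Z hZ)
    rw [card_compl, Fintype.card_fin] at h3
    rw [abs_le] at h2 h3 hT ⊢
    constructor <;> linarith
  rw [hz1, hz2]
  constructor
  · rintro (⟨hu, hv⟩ | ⟨hu, hv⟩)
    · exact same X hX hu hv
    · rw [← crossingPairs_compl]
      exact same Xᶜ (hcompl X hX) hu hv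
  · intro h
    by_cases hu : u ∈ X
    · exact diff X hX hu fun hv => h (Or.inl ⟨hu, hv⟩)
    · rw [← crossingPairs_compl]
      refine diff Xᶜ (hcompl X hX) (mem_compl.2 hu) fun hv => h (Or.inr ⟨mem_compl.2 hu, hv⟩)

lemma two_pow_card_crossing_le (n k : ℕ) (X : Finset (Fin n)) :
    (2 : ℝ) ^ #(crossing n k X Xᶜ) ≤ (Bip n k).ncard := by
  have h : ((crossing n k X Xᶜ).powerset : Set (Finset (Finset (Fin n)))) ⊆ Bip n k := by
    intro H hH
    have hH' : H ⊆ crossing n k X Xᶜ := by simpa using hH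
    refine ⟨fun e he => ?_, X, Xᶜ, disjoint_compl_right, union_compl X, fun e he => ?_⟩
    · exact (mem_powersetCard.1 (mem_filter.1 (hH' he)).1).2
    · exact (mem_filter.1 (hH' he)).2
  have := Set.ncard_le_ncard h (Set.toFinite _)
  rw [Set.ncard_coe_finset, card_powerset] at this
  exact_mod_cast this

open Classical in
/-- A balanced bipartition is rarely non-standard. -/
lemma exists_card_not_standard_le_of_balanced (k : ℕ) (hk : 2 ≤ k) (σ : ℝ) (hσ0 : 0 < σ)
    (hσ1 : σ ≤ 1) :
    ∃ δ : ℝ, 0 < δ ∧ ∃ N : ℕ, ∀ n : ℕ, N ≤ n → ∀ X : Finset (Fin n),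
      |(#X : ℝ) - 1 / 2 * n| ≤ δ * n →
        (#{H ∈ (crossing n k X Xᶜ).powerset | ¬ SigmaStandardWrt n k σ H X Xᶜ} : ℝ) ≤
          (n : ℝ) ^ 2 * (2 * (Bip n k).ncard * Real.exp (-((σ / 8) ^ 2 * n.choose (k - 1)))) := by
  obtain ⟨δ, hδ, N, hN⟩ := exists_crossingPairs_close k hk (σ / 2) (by positivity)
  refine ⟨δ, hδ, N, fun n hn X hX => ?_⟩
  have hsub : {H ∈ (crossing n k X Xᶜ).powerset | ¬ SigmaStandardWrt n k σ H X Xᶜ} ⊆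
      ({p : Fin n × Fin n | p.1 ≠ p.2} : Finset _).biUnion fun p =>
        {H ∈ (crossing n k X Xᶜ).powerset | σ / 8 * n.choose (k - 1) <
          |(jointDeg n k H p.1 p.2 : ℝ) - #(crossingPairs n k X p.1 p.2) / 4|} := by
    intro H hH
    rw [mem_filter] at hH
    by_contra hcon
    simp only [mem_biUnion, mem_filter, mem_univ, true_and, Prod.exists, not_exists, not_and,
      not_lt] at hcon
    refine hH.2 fun u v huv => ?_
    have h1 := hcon u v huv hH.1
    have h2 := hN n hn X hX u v huv
    constructor
    · intro h
      have h3 := h2.1 h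
      rw [abs_le] at h1 h3 ⊢
      constructor <;> linarith
    · intro h
      have h3 := h2.2 h
      rw [abs_le] at h1 h3 ⊢
      constructor <;> linarith
  have hcard : (#{H ∈ (crossing n k X Xᶜ).powerset | ¬ SigmaStandardWrt n k σ H X Xᶜ} : ℝ) ≤
      ∑ p ∈ ({p : Fin n × Fin n | p.1 ≠ p.2} : Finset _),
        (#{H ∈ (crossing n k X Xᶜ).powerset | σ / 8 * n.choose (k - 1) <
          |(jointDeg n k H p.1 p.2 : ℝ) - #(crossingPairs n k X p.1 p.2) / 4|} : ℝ) := by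
    exact_mod_cast (card_le_card hsub).trans card_biUnion_le
  refine hcard.trans ((sum_le_card_nsmul _ _
    (2 * (Bip n k).ncard * Real.exp (-((σ / 8) ^ 2 * n.choose (k - 1)))) fun p hp => ?_).trans ?_)
  · refine (card_jointDeg_deviation_le n k X (mem_filter.1 hp).2 (σ / 8) (by positivity)
      (by linarith)).trans ?_
    gcongr
    exact two_pow_card_crossing_le n k X
  · rw [nsmul_eq_mul]
    gcongr
    have := card_filter_le (univ : Finset (Fin n × Fin n)) (fun p => p.1 ≠ p.2)
    rw [card_univ, Fintype.card_prod, Fintype.card_fin, ← sq] at this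
    exact_mod_cast this

/-- An unbalanced bipartition has substantially fewer crossing sets than the largest possible
number. -/
lemma exists_two_pow_card_crossing_le_of_unbalanced (k : ℕ) (hk : 2 ≤ k) (δ : ℝ) (hδ : 0 < δ) :
    ∃ c : ℝ, 0 < c ∧ ∃ N : ℕ, ∀ n : ℕ, N ≤ n → ∀ X : Finset (Fin n),
      δ * n < |(#X : ℝ) - 1 / 2 * n| →
        (2 : ℝ) ^ #(crossing n k X Xᶜ) ≤
          (Bip n k).ncard * (2 : ℝ) ^ (-(c * n.choose k)) := by
  obtain ⟨m, rfl⟩ := Nat.exists_eq_add_of_le' hk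
  obtain ⟨c, hc⟩ : ∃ c, c = (1 / 2 : ℝ) ^ m * (2 * δ ^ 2) := ⟨_, rfl⟩
  have hc0 : 0 < c := by rw [hc]; positivity
  obtain ⟨ε, hε, N, hN⟩ := exists_abs_choose_sub_le (m + 2) (c / 8) (by positivity)
  obtain ⟨N', hN'⟩ := exists_nat_ge (1 / ε)
  refine ⟨c / 2, by positivity, max (max N N') 1, fun n hn X hX => ?_⟩
  have hNn : N ≤ n := (le_max_left _ _).trans ((le_max_left _ _).trans hn)
  have hn0 : (0 : ℝ) < n := by exact_mod_cast (le_max_right _ _).trans hn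
  have hεn : 1 ≤ ε * n := by
    have : (N' : ℝ) ≤ n := by exact_mod_cast (le_max_right _ _).trans ((le_max_left _ _).trans hn)
    rw [div_le_iff₀ hε] at hN'
    nlinarith
  obtain ⟨X₀, -, hX₀⟩ := exists_subset_card_eq (s := (univ : Finset (Fin n))) (n := n / 2)
    (by rw [card_univ, Fintype.card_fin]; omega)
  have hXn : #X ≤ n := (card_le_univ _).trans (Fintype.card_fin n).le
  have hXn' : (#X : ℝ) ≤ n := by exact_mod_cast hXn
  have e1 : (#(crossing n (m + 2) X Xᶜ) : ℝ) + (#X).choose (m + 2) + (n - #X).choose (m + 2) =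
      n.choose (m + 2) := by exact_mod_cast card_crossing n (m + 2) (by omega) X
  have e2 : (#(crossing n (m + 2) X₀ X₀ᶜ) : ℝ) + (n / 2 : ℕ).choose (m + 2) +
      (n - n / 2 : ℕ).choose (m + 2) = n.choose (m + 2) := by
    rw [← hX₀]
    exact_mod_cast card_crossing n (m + 2) (by omega) X₀
  have hexact : ∀ x : ℕ, x ≤ n →
      |(x.choose (m + 2) : ℝ) - ((x : ℝ) / n) ^ (m + 2) * n.choose (m + 2)| ≤
        c / 8 * n.choose (m + 2) := by
    intro x hx
    have hx' : (x : ℝ) ≤ n := by exact_mod_cast hx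
    refine hN n hNn x hx _ (by positivity) ((div_le_one hn0).2 hx') ?_
    rw [div_mul_cancel₀ _ hn0.ne', sub_self, abs_zero]
    positivity
  have hhalf : ∀ x : ℕ, x ≤ n → n ≤ 2 * x + 2 → 2 * x ≤ n + 2 →
      |(x.choose (m + 2) : ℝ) - (1 / 2) ^ (m + 2) * n.choose (m + 2)| ≤
        c / 8 * n.choose (m + 2) := by
    intro x hx h1 h2
    have h1' : (n : ℝ) ≤ 2 * x + 2 := by exact_mod_cast h1
    have h2' : 2 * (x : ℝ) ≤ n + 2 := by exact_mod_cast h2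
    refine hN n hNn x hx _ (by norm_num) (by norm_num) ?_
    rw [abs_le]
    constructor <;> linarith
  have b1 := (abs_le.1 (hexact #X hXn)).1
  have b2 := (abs_le.1 (hexact (n - #X) (Nat.sub_le _ _))).1
  have b3 := (abs_le.1 (hhalf (n / 2) (by omega) (by omega) (by omega))).2
  have b4 := (abs_le.1 (hhalf (n - n / 2) (by omega) (by omega) (by omega))).2
  obtain ⟨s, hs⟩ : ∃ s : ℝ, s = (#X : ℝ) / n := ⟨_, rfl⟩
  have hs' : ((n - #X : ℕ) : ℝ) / n = 1 - s := by
    rw [Nat.cast_sub hXn, hs, sub_div, div_self hn0.ne']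
  have hs0 : 0 ≤ s := by rw [hs]; positivity
  have hs1 : s ≤ 1 := by rw [hs]; exact (div_le_one hn0).2 hXn'
  have hsδ : δ ^ 2 ≤ (s - 1 / 2) ^ 2 := by
    have : δ ≤ |s - 1 / 2| := by
      refine le_of_mul_le_mul_right (hX.le.trans_eq ?_) hn0
      rw [show (#X : ℝ) - 1 / 2 * n = (s - 1 / 2) * n by rw [hs]; field_simp, abs_mul,
        abs_of_pos hn0]
    rw [← sq_abs (s - 1 / 2)]
    gcongr
  have hconv := pow_add_pow_ge s (1 - s) hs0 (by linarith) m
  have hgain : 2 * (1 / 2 : ℝ) ^ (m + 2) + c ≤ s ^ (m + 2) + (1 - s) ^ (m + 2) := by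
    refine le_trans ?_ hconv
    rw [add_sub_cancel, hc, show 2 * (1 / 2 : ℝ) ^ (m + 2) + (1 / 2 : ℝ) ^ m * (2 * δ ^ 2) =
      (1 / 2 : ℝ) ^ m * (1 / 2 + 2 * δ ^ 2) by ring]
    exact mul_le_mul_of_nonneg_left (by linarith) (by positivity)
  rw [hs'] at b2
  rw [← hs] at b1
  have hdiff : (#(crossing n (m + 2) X Xᶜ) : ℝ) ≤
      #(crossing n (m + 2) X₀ X₀ᶜ) + -(c / 2 * n.choose (m + 2)) := by
    have := mul_le_mul_of_nonneg_right hgain (Nat.cast_nonneg (α := ℝ) (n.choose (m + 2)))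
    linarith
  rw [← Real.rpow_natCast]
  refine (Real.rpow_le_rpow_of_exponent_le one_le_two hdiff).trans ?_
  rw [Real.rpow_add two_pos, Real.rpow_natCast]
  gcongr
  exact two_pow_card_crossing_le n (m + 2) X₀

open Classical in
lemma ncard_not_standard_le_sum (n k : ℕ) (σ : ℝ) :
    ({H ∈ Bip n k | ¬ SigmaStandard n k σ H}.ncard : ℝ) ≤
      ∑ X : Finset (Fin n),
        (#{H ∈ (crossing n k X Xᶜ).powerset | ¬ SigmaStandardWrt n k σ H X Xᶜ} : ℝ) := by
  have hsub : {H ∈ Bip n k | ¬ SigmaStandard n k σ H} ⊆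
      ((univ : Finset (Finset (Fin n))).biUnion fun X =>
        {H ∈ (crossing n k X Xᶜ).powerset | ¬ SigmaStandardWrt n k σ H X Xᶜ} :
        Finset (Finset (Finset (Fin n)))) := by
    rintro H ⟨⟨hH, -⟩, hns⟩
    unfold SigmaStandard at hns
    push Not at hns
    obtain ⟨X, Y, ⟨hdis, hun, hbip⟩, hst⟩ := hns
    have hY : Y = Xᶜ := (IsCompl.of_eq (disjoint_iff.1 hdis) hun).compl_eq.symm
    subst hY
    simp only [coe_biUnion, Set.mem_iUnion, mem_coe, mem_filter, mem_powerset]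
    refine ⟨X, mem_univ _, fun e he => ?_, hst⟩
    exact mem_filter.2 ⟨mem_powersetCard.2 ⟨subset_univ _, hH e he⟩, hbip e he⟩
  have h := Set.ncard_le_ncard hsub (Set.toFinite _)
  rw [Set.ncard_coe_finset] at h
  exact_mod_cast h.trans card_biUnion_le

theorem stmt4 (k : ℕ) (hk : 3 ≤ k) (σ : ℝ) (hσ0 : 0 < σ) (hσ1 : σ < (2 : ℝ) ^ (-(k : ℤ))) :
    ∃ c : ℝ, 0 < c ∧ ∃ N : ℕ, ∀ n : ℕ, N ≤ n →
      (({H ∈ Bip n k | ¬ SigmaStandard n k σ H}.ncard : ℝ))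
        ≤ ((Bip n k).ncard : ℝ) * (2 : ℝ) ^ (-(c * (n : ℝ) ^ (k - 1))) := by
  classical
  have hσ : σ ≤ 1 := hσ1.le.trans (zpow_le_one_of_nonpos₀ one_le_two (by simp))
  obtain ⟨δ, hδ, N₁, hbal⟩ := exists_card_not_standard_le_of_balanced k (by omega) σ hσ0 hσ
  obtain ⟨c, hc, N₂, hunb⟩ := exists_two_pow_card_crossing_le_of_unbalanced k (by omega) δ hδ
  obtain ⟨a, ha⟩ : ∃ a : ℝ, a = min ((σ / 8) ^ 2 / (2 * (k - 1).factorial))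
    (c / (2 * k.factorial)) := ⟨_, rfl⟩
  have ha0 : 0 < a := by
    rw [ha]
    exact lt_min (by positivity) (by positivity)
  have ha1 : a ≤ (σ / 8) ^ 2 / (2 * (k - 1).factorial) := ha ▸ min_le_left _ _
  have ha2 : a ≤ c / (2 * k.factorial) := ha ▸ min_le_right _ _
  obtain ⟨N₃, hN₃⟩ := exists_nat_ge (8 / a)
  refine ⟨a / 2, by positivity, max (max N₁ N₂) (max N₃ (2 * k ^ 2)), fun n hn => ?_⟩
  simp only [max_le_iff] at hn
  obtain ⟨⟨hn₁, hn₂⟩, hn₃, hn₄⟩ := hn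
  have hn1 : 1 ≤ n := by nlinarith
  have hn1' : (1 : ℝ) ≤ n := by exact_mod_cast hn1
  have hchoose := pow_div_le_choose k n hn₄
  have hchoose' := pow_div_le_choose (k - 1) n
    (le_trans (Nat.mul_le_mul_left _ (Nat.pow_le_pow_left (Nat.sub_le k 1) 2)) hn₄)
  have hB : (0 : ℝ) ≤ (Bip n k).ncard := Nat.cast_nonneg _
  obtain ⟨P, hP⟩ : ∃ P : ℝ, P = (n : ℝ) ^ (k - 1) := ⟨_, rfl⟩
  have hP0 : 0 ≤ P := by rw [hP]; positivity
  have hexp1 : a * P ≤ (σ / 8) ^ 2 * n.choose (k - 1) :=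
    calc a * P ≤ (σ / 8) ^ 2 / (2 * (k - 1).factorial) * P := by gcongr
      _ = (σ / 8) ^ 2 * ((n : ℝ) ^ (k - 1) / (2 * (k - 1).factorial)) := by rw [hP]; ring
      _ ≤ _ := by gcongr
  have hexp2 : a * P ≤ c * n.choose k :=
    calc a * P ≤ c / (2 * k.factorial) * (n : ℝ) ^ k := by
          gcongr
          rw [hP]
          exact pow_le_pow_right₀ hn1' (Nat.sub_le _ _)
      _ = c * ((n : ℝ) ^ k / (2 * k.factorial)) := by ring
      _ ≤ _ := by gcongr
  have hn2n : (n : ℝ) ≤ 2 ^ n := by exact_mod_cast Nat.lt_two_pow_self.le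
  have h2n : (2 : ℝ) ≤ 2 ^ n := le_self_pow₀ one_le_two (by omega)
  have hfac : 1 ≤ (n : ℝ) ^ 2 * 2 := by nlinarith
  have hterm : ∀ X : Finset (Fin n),
      (#{H ∈ (crossing n k X Xᶜ).powerset | ¬ SigmaStandardWrt n k σ H X Xᶜ} : ℝ) ≤
        (n : ℝ) ^ 2 * 2 * ((Bip n k).ncard * (2 : ℝ) ^ (-(a * P))) := by
    intro X
    rcases le_or_gt |(#X : ℝ) - 1 / 2 * n| (δ * n) with hX | hX
    · refine (hbal n hn₁ X hX).trans ?_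
      have : Real.exp (-((σ / 8) ^ 2 * n.choose (k - 1))) ≤ (2 : ℝ) ^ (-(a * P)) := by
        rw [Real.rpow_def_of_pos two_pos, Real.exp_le_exp]
        have hlog : Real.log 2 ≤ 1 := by linarith [Real.log_two_lt_d9]
        have := mul_le_mul_of_nonneg_right hlog (mul_nonneg ha0.le hP0)
        linarith
      calc _ = (n : ℝ) ^ 2 * 2 * ((Bip n k).ncard *
            Real.exp (-((σ / 8) ^ 2 * n.choose (k - 1)))) := by ring
        _ ≤ _ := by gcongr
    · have h1 : (#{H ∈ (crossing n k X Xᶜ).powerset | ¬ SigmaStandardWrt n k σ H X Xᶜ} : ℝ) ≤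
          2 ^ #(crossing n k X Xᶜ) := by
        exact_mod_cast (card_filter_le _ _).trans (card_powerset _).le
      refine (h1.trans (hunb n hn₂ X hX)).trans ?_
      have : (2 : ℝ) ^ (-(c * n.choose k)) ≤ (2 : ℝ) ^ (-(a * P)) :=
        Real.rpow_le_rpow_of_exponent_le one_le_two (by linarith)
      refine le_trans (by gcongr) (le_mul_of_one_le_left (by positivity) hfac)
  have hlin : 4 * (n : ℝ) ≤ a / 2 * P := by
    have h1 : 8 ≤ a * n := by
      have : (N₃ : ℝ) ≤ n := by exact_mod_cast hn₃
      rw [div_le_iff₀ ha0] at hN₃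
      nlinarith
    have h2 : (n : ℝ) ^ 2 ≤ P := by
      rw [hP]
      exact pow_le_pow_right₀ hn1' (by omega)
    nlinarith
  have hpre : (2 : ℝ) ^ n * ((n : ℝ) ^ 2 * 2) ≤ (2 : ℝ) ^ (4 * (n : ℝ)) := by
    calc (2 : ℝ) ^ n * ((n : ℝ) ^ 2 * 2) ≤ 2 ^ n * ((2 ^ n) ^ 2 * 2 ^ n) := by gcongr
      _ = 2 ^ (4 * n) := by ring
      _ = _ := by rw [← Real.rpow_natCast]; push_cast; rfl
  calc (({H ∈ Bip n k | ¬ SigmaStandard n k σ H}.ncard : ℝ))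
      ≤ ∑ X : Finset (Fin n), (n : ℝ) ^ 2 * 2 * ((Bip n k).ncard * (2 : ℝ) ^ (-(a * P))) :=
        (ncard_not_standard_le_sum n k σ).trans (sum_le_sum fun X _ => hterm X)
    _ = (2 : ℝ) ^ n * ((n : ℝ) ^ 2 * 2) * ((Bip n k).ncard * (2 : ℝ) ^ (-(a * P))) := by
        rw [sum_const, card_univ, Fintype.card_finset, Fintype.card_fin, nsmul_eq_mul]
        push_cast
        ring
    _ ≤ (2 : ℝ) ^ (4 * (n : ℝ)) * ((Bip n k).ncard * (2 : ℝ) ^ (-(a * P))) := by gcongr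
    _ = (Bip n k).ncard * (2 : ℝ) ^ (4 * (n : ℝ) + -(a * P)) := by
        rw [Real.rpow_add two_pos]
        ring
    _ ≤ (Bip n k).ncard * (2 : ℝ) ^ (-(a / 2 * (n : ℝ) ^ (k - 1))) := by
        rw [← hP]
        gcongr
        · exact one_le_two
        · linarith
end

section
/- Fix an integer k ≥ 3 and a real δ ∈ (0,1). There exist c > 0 and N such that for every n ≥ N and every partition [n] = X ∪ Y with |X|, |Y| ≥ (1−δ)n/2, the number of k-graphs H on [n] with E_H ⊆ K[X,Y] for which some x ∈ X has |deg_H(x,Y) − (1/2)·C(|Y|,k−1)| > δ·(1/2)·C(|Y|,k−1) or some y ∈ Y has |deg_H(y,X) − (1/2)·C(|X|,k−1)| > δ·(1/2)·C(|X|,k−1) is at most 2^{|K[X,Y]|} · 2^{−c·n^{k−1}}. -/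
open Finset

theorem sum_powerset_exp_le {α : Type*} [DecidableEq α] {K S : Finset α} (hS : S ⊆ K) (t : ℝ) :
    ∑ H ∈ K.powerset, Real.exp (t * (2 * ((H ∩ S).card : ℝ) - S.card)) ≤
      2 ^ K.card * Real.exp (t ^ 2 / 2 * S.card) := by
  have hterm : ∀ H ∈ K.powerset, Real.exp (t * (2 * ((H ∩ S).card : ℝ) - S.card)) =
      (∏ i ∈ H, Real.exp (if i ∈ S then t else 0)) *
        ∏ i ∈ K \ H, Real.exp (-(if i ∈ S then t else 0)) := by
    intro H _
    rw [← Real.exp_sum, ← Real.exp_sum, ← Real.exp_add, Finset.sum_neg_distrib,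
      Finset.sum_ite_mem, Finset.sum_ite_mem, Finset.sum_const, Finset.sum_const,
      nsmul_eq_mul, nsmul_eq_mul]
    have h1 : (K \ H) ∩ S = S \ H := by
      ext i
      simp only [Finset.mem_inter, Finset.mem_sdiff]
      exact ⟨fun h => ⟨h.2, h.1.2⟩, fun h => ⟨⟨hS h.1, h.2⟩, h.1⟩⟩
    have h2 : ((S \ H).card : ℝ) + (H ∩ S).card = S.card := by
      rw [Finset.inter_comm]
      exact_mod_cast Finset.card_sdiff_add_card_inter S H
    rw [h1, ← h2]
    ring_nf
  rw [Finset.sum_congr rfl hterm, ← Finset.prod_add]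
  calc ∏ i ∈ K, (Real.exp (if i ∈ S then t else 0) + Real.exp (-(if i ∈ S then t else 0)))
      ≤ ∏ i ∈ K, (2 * Real.exp (if i ∈ S then t ^ 2 / 2 else 0)) := by
        refine Finset.prod_le_prod (fun i _ => by positivity) fun i _ => ?_
        have h := Real.cosh_le_exp_half_sq (if i ∈ S then t else 0)
        rw [Real.cosh_eq] at h
        split_ifs at h ⊢ <;> simp at h ⊢ <;> linarith
    _ = 2 ^ K.card * Real.exp (t ^ 2 / 2 * S.card) := by
        rw [Finset.prod_mul_distrib, Finset.prod_const, ← Real.exp_sum, Finset.sum_ite_mem,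
          Finset.inter_eq_right.2 hS, Finset.sum_const, nsmul_eq_mul, mul_comm (S.card : ℝ)]

theorem card_filter_powerset_deviation_le {α : Type*} [DecidableEq α] {K S : Finset α}
    (hS : S ⊆ K) {δ : ℝ} (hδ : 0 < δ) :
    ((K.powerset.filter fun H => δ * ((1 / 2 : ℝ) * S.card) <
        |((H ∩ S).card : ℝ) - (1 / 2 : ℝ) * S.card|).card : ℝ) ≤
      2 * 2 ^ K.card * Real.exp (-(δ ^ 2 / 2 * S.card)) := by
  set F := K.powerset.filter fun H => δ * ((1 / 2 : ℝ) * S.card) <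
        |((H ∩ S).card : ℝ) - (1 / 2 : ℝ) * S.card|
  have hsum : (F.card : ℝ) * Real.exp (δ ^ 2 * S.card) ≤
      2 * (2 ^ K.card * Real.exp (δ ^ 2 / 2 * S.card)) := by
    calc (F.card : ℝ) * Real.exp (δ ^ 2 * S.card)
        = ∑ H ∈ F, Real.exp (δ ^ 2 * S.card) := by rw [Finset.sum_const, nsmul_eq_mul]
      _ ≤ ∑ H ∈ F, (Real.exp (δ * (2 * ((H ∩ S).card : ℝ) - S.card)) +
            Real.exp (-δ * (2 * ((H ∩ S).card : ℝ) - S.card))) := by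
          refine Finset.sum_le_sum fun H hH => ?_
          rcases lt_abs.1 (Finset.mem_filter.1 hH).2 with h | h
          · refine le_add_of_le_of_nonneg (Real.exp_le_exp.2 ?_) (Real.exp_pos _).le
            nlinarith
          · refine le_add_of_nonneg_of_le (Real.exp_pos _).le (Real.exp_le_exp.2 ?_)
            nlinarith
      _ ≤ ∑ H ∈ K.powerset, (Real.exp (δ * (2 * ((H ∩ S).card : ℝ) - S.card)) +
            Real.exp (-δ * (2 * ((H ∩ S).card : ℝ) - S.card))) :=
          Finset.sum_le_sum_of_subset_of_nonneg (Finset.filter_subset _ _)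
            fun _ _ _ => by positivity
      _ ≤ 2 * (2 ^ K.card * Real.exp (δ ^ 2 / 2 * S.card)) := by
          rw [Finset.sum_add_distrib]
          have h1 := sum_powerset_exp_le hS δ
          have h2 := sum_powerset_exp_le hS (-δ)
          rw [neg_sq] at h2
          linarith
  rw [← mul_le_mul_iff_left₀ (Real.exp_pos (δ ^ 2 * S.card))]
  refine hsum.trans_eq ?_
  rw [mul_assoc, mul_assoc, ← Real.exp_add]
  ring_nf

theorem crossing_comm (n k : ℕ) (X Y : Finset (Fin n)) : crossing n k X Y = crossing n k Y X := by
  simp only [crossing, and_comm]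

theorem card_deviating_degree_le {n k : ℕ} (hk : 2 ≤ k) {X Y : Finset (Fin n)}
    (hXY : Disjoint X Y) {δ : ℝ} (hδ : 0 < δ) {x : Fin n} (hx : x ∈ X) :
    (((crossing n k X Y).powerset.filter fun H =>
        δ * ((1 / 2 : ℝ) * (Y.card.choose (k - 1) : ℝ)) <
          |(degIn n k H x Y : ℝ) - (1 / 2 : ℝ) * (Y.card.choose (k - 1) : ℝ)|).card : ℝ) ≤
      2 * 2 ^ (crossing n k X Y).card *
        Real.exp (-(δ ^ 2 / 2 * (Y.card.choose (k - 1) : ℝ))) := by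
  have hxY : x ∉ Y := Finset.disjoint_left.1 hXY hx
  have hnot : ∀ J ∈ Y.powersetCard (k - 1), x ∉ J := fun J hJ h =>
    hxY ((Finset.mem_powersetCard.1 hJ).1 h)
  have hinj : Set.InjOn (insert x) (Y.powersetCard (k - 1) : Set (Finset (Fin n))) := by
    intro J hJ J' hJ' h
    rw [← Finset.erase_insert (hnot J hJ), ← Finset.erase_insert (hnot J' hJ'), h]
  set S := (Y.powersetCard (k - 1)).image (insert x) with hSdef
  have hcard : S.card = Y.card.choose (k - 1) := by
    rw [hSdef, Finset.card_image_of_injOn hinj, Finset.card_powersetCard]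
  have hS : S ⊆ crossing n k X Y := by
    intro e he
    obtain ⟨J, hJ, rfl⟩ := Finset.mem_image.1 he
    have hJ' := Finset.mem_powersetCard.1 hJ
    refine Finset.mem_filter.2 ⟨Finset.mem_powersetCard.2 ⟨Finset.subset_univ _, ?_⟩, ?_, ?_⟩
    · rw [Finset.card_insert_of_notMem (hnot J hJ)]
      omega
    · intro h
      obtain ⟨j, hj⟩ : J.Nonempty := Finset.card_pos.1 (by omega)
      exact Finset.disjoint_left.1 hXY (h (Finset.mem_insert_of_mem hj)) (hJ'.1 hj)
    · exact fun h => hxY (h (Finset.mem_insert_self _ _))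
  have hdeg : ∀ H : Finset (Finset (Fin n)), degIn n k H x Y = (H ∩ S).card := by
    intro H
    rw [degIn, Finset.sdiff_singleton_eq_erase, Finset.erase_eq_of_notMem hxY, hSdef,
      Finset.inter_comm, ← Finset.filter_mem_eq_inter, Finset.filter_image,
      Finset.card_image_of_injOn (hinj.mono (by exact_mod_cast Finset.filter_subset _ _))]
  simp only [hdeg, ← hcard]
  exact card_filter_powerset_deviation_le hS hδ

theorem exists_mul_pow_le_choose {a : ℝ} (ha : 0 < a) (r : ℕ) :
    ∃ b : ℝ, 0 < b ∧ ∃ N : ℕ, ∀ n m : ℕ, N ≤ n → a * n ≤ m → b * n ^ r ≤ m.choose r := by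
  refine ⟨(a / 2) ^ r / r.factorial, by positivity, ⌈2 * r / a⌉₊, fun n m hn hm => ?_⟩
  have hn' : 2 * r / a ≤ (n : ℝ) := Nat.ceil_le.1 hn
  rw [div_le_iff₀ ha] at hn'
  have hsub : a / 2 * n ≤ ((m + 1 - r : ℕ) : ℝ) := by
    have h : (m : ℝ) + 1 ≤ ((m + 1 - r : ℕ) : ℝ) + r := by exact_mod_cast le_tsub_add
    linarith
  calc (a / 2) ^ r / r.factorial * (n : ℝ) ^ r = (a / 2 * n) ^ r / r.factorial := by
        rw [mul_pow]; ring
    _ ≤ ((m + 1 - r : ℕ) : ℝ) ^ r / r.factorial := by gcongr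
    _ ≤ m.choose r := Nat.pow_le_choose r m

theorem stmt9 (k : ℕ) (hk : 3 ≤ k) (δ : ℝ) (hδ0 : 0 < δ) (hδ1 : δ < 1) :
    ∃ c : ℝ, 0 < c ∧ ∃ N : ℕ, ∀ n : ℕ, N ≤ n →
      ∀ X Y : Finset (Fin n), Disjoint X Y → X ∪ Y = Finset.univ →
        (1 - δ) * n / 2 ≤ (X.card : ℝ) → (1 - δ) * n / 2 ≤ (Y.card : ℝ) →
        (({H : Finset (Finset (Fin n)) | H ⊆ crossing n k X Y ∧
            ((∃ x ∈ X, δ * ((1 / 2 : ℝ) * (Y.card.choose (k - 1) : ℝ)) <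
                |(degIn n k H x Y : ℝ) - (1 / 2 : ℝ) * (Y.card.choose (k - 1) : ℝ)|) ∨
             (∃ y ∈ Y, δ * ((1 / 2 : ℝ) * (X.card.choose (k - 1) : ℝ)) <
                |(degIn n k H y X : ℝ) - (1 / 2 : ℝ) * (X.card.choose (k - 1) : ℝ)|))}.ncard : ℝ))
          ≤ (2 : ℝ) ^ ((crossing n k X Y).card) * (2 : ℝ) ^ (-(c * (n : ℝ) ^ (k - 1))) := by
  obtain ⟨b, hb, N, hN⟩ := exists_mul_pow_le_choose (a := (1 - δ) / 2) (by linarith) (k - 1)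
  set c := δ ^ 2 * b / 4 with hc
  have hc0 : 0 < c := by positivity
  refine ⟨c, hc0, max (max N 1) ⌈2 / c⌉₊, fun n hn X Y hXY hU hX hY => ?_⟩
  simp only [max_le_iff] at hn
  obtain ⟨⟨hnN, hn1⟩, hnc⟩ := hn
  set K := crossing n k X Y with hK
  set P : ℝ := (n : ℝ) ^ (k - 1) with hP
  have hbound : ∀ Z : Finset (Fin n), (1 - δ) * n / 2 ≤ (Z.card : ℝ) →
      Real.exp (-(δ ^ 2 / 2 * (Z.card.choose (k - 1) : ℝ))) ≤ Real.exp (-(2 * c * P)) := by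
    intro Z hZ
    have h := hN n Z.card hnN (by linarith)
    have h' := mul_le_mul_of_nonneg_left h (by positivity : 0 ≤ δ ^ 2 / 2)
    refine Real.exp_le_exp.2 (neg_le_neg ?_)
    rw [hc]
    linarith
  let F (Z : Finset (Fin n)) (v : Fin n) := K.powerset.filter fun H =>
    δ * ((1 / 2 : ℝ) * (Z.card.choose (k - 1) : ℝ)) <
      |(degIn n k H v Z : ℝ) - (1 / 2 : ℝ) * (Z.card.choose (k - 1) : ℝ)|
  have hFX : ∀ x ∈ X, ((F Y x).card : ℝ) ≤ 2 * 2 ^ K.card * Real.exp (-(2 * c * P)) :=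
    fun x hx => (card_deviating_degree_le (by omega) hXY hδ0 hx).trans
      (mul_le_mul_of_nonneg_left (hbound Y hY) (by positivity))
  have hFY : ∀ y ∈ Y, ((F X y).card : ℝ) ≤ 2 * 2 ^ K.card * Real.exp (-(2 * c * P)) := by
    intro y hy
    have h := card_deviating_degree_le (k := k) (by omega) hXY.symm hδ0 hy
    rw [crossing_comm] at h
    exact h.trans (mul_le_mul_of_nonneg_left (hbound X hX) (by positivity))
  have hcover : ∀ H : Finset (Finset (Fin n)), (H ⊆ K ∧
      ((∃ x ∈ X, δ * ((1 / 2 : ℝ) * (Y.card.choose (k - 1) : ℝ)) <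
          |(degIn n k H x Y : ℝ) - (1 / 2 : ℝ) * (Y.card.choose (k - 1) : ℝ)|) ∨
        (∃ y ∈ Y, δ * ((1 / 2 : ℝ) * (X.card.choose (k - 1) : ℝ)) <
          |(degIn n k H y X : ℝ) - (1 / 2 : ℝ) * (X.card.choose (k - 1) : ℝ)|))) →
      H ∈ X.biUnion (F Y) ∪ Y.biUnion (F X) := by
    rintro H ⟨hHK, ⟨x, hx, h⟩ | ⟨y, hy, h⟩⟩
    · exact Finset.mem_union_left _ (Finset.mem_biUnion.2
        ⟨x, hx, Finset.mem_filter.2 ⟨Finset.mem_powerset.2 hHK, h⟩⟩)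
    · exact Finset.mem_union_right _ (Finset.mem_biUnion.2
        ⟨y, hy, Finset.mem_filter.2 ⟨Finset.mem_powerset.2 hHK, h⟩⟩)
  have hncard := Set.ncard_le_ncard (t := ↑(X.biUnion (F Y) ∪ Y.biUnion (F X)))
    (fun H hH => Finset.mem_coe.2 (hcover H hH)) (Finset.finite_toSet _)
  rw [Set.ncard_coe_finset] at hncard
  have hcardU : (X.card : ℝ) + Y.card = n := by
    rw [← Nat.cast_add, ← Finset.card_union_of_disjoint hXY, hU, Finset.card_univ,
      Fintype.card_fin]
  have hunion : ((X.biUnion (F Y) ∪ Y.biUnion (F X)).card : ℝ) ≤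
      n * (2 * 2 ^ K.card * Real.exp (-(2 * c * P))) := by
    calc ((X.biUnion (F Y) ∪ Y.biUnion (F X)).card : ℝ)
        ≤ ∑ x ∈ X, ((F Y x).card : ℝ) + ∑ y ∈ Y, ((F X y).card : ℝ) := by
          exact_mod_cast (Finset.card_union_le _ _).trans
            (add_le_add Finset.card_biUnion_le Finset.card_biUnion_le)
      _ ≤ _ := by
          rw [← hcardU, add_mul, ← nsmul_eq_mul, ← nsmul_eq_mul]
          exact add_le_add (Finset.sum_le_card_nsmul _ _ _ hFX)
            (Finset.sum_le_card_nsmul _ _ _ hFY)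
  have hn1' : (1 : ℝ) ≤ n := by exact_mod_cast hn1
  have hPn : (n : ℝ) ^ 2 ≤ P := pow_le_pow_right₀ hn1' (by omega)
  have hnc' : 2 ≤ n * c := (div_le_iff₀ hc0).1 (Nat.ceil_le.1 hnc)
  have h2n : 2 * (n : ℝ) ≤ Real.exp (c * P) := by
    have h := Real.add_one_le_exp (c * P)
    nlinarith
  have htwo : Real.exp (-(c * P)) ≤ (2 : ℝ) ^ (-(c * P)) := by
    rw [Real.rpow_def_of_pos two_pos]
    refine Real.exp_le_exp.2 ?_
    have hlog : Real.log 2 ≤ 1 := by linarith [Real.log_two_lt_d9]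
    have hcP : 0 ≤ c * P := by positivity
    nlinarith
  calc _ ≤ ((X.biUnion (F Y) ∪ Y.biUnion (F X)).card : ℝ) := by exact_mod_cast hncard
    _ ≤ n * (2 * 2 ^ K.card * Real.exp (-(2 * c * P))) := hunion
    _ = 2 ^ K.card * (2 * n * Real.exp (-(2 * c * P))) := by ring
    _ ≤ 2 ^ K.card * (Real.exp (c * P) * Real.exp (-(2 * c * P))) := by gcongr
    _ = 2 ^ K.card * Real.exp (-(c * P)) := by rw [← Real.exp_add]; ring_nf
    _ ≤ 2 ^ K.card * (2 : ℝ) ^ (-(c * P)) := by gcongr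
end
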